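/- Let T be a finite edge-weighted tree with at least two vertices, rooted at the homebase r, with invoking cost q ≥ 0, and assume every vertex of T other than r and the leaves has at least two children. Define the labeling k recursively by: k(v) = 1 for every leaf v; and for a non-leaf vertex v with children u_1, …, u_m, k(v) = max{1, Σ_{j=1}^m κ(u_j)}, where κ(u_j) = k(u_j) − 1 if k(u_j) = 1 and d(v, f(u_j)) ≤ d(r, v) + q (f(u_j) being a leaf of T_{u_j} at maximum distance from u_j), and κ(u_j) = k(u_j) otherwise. Then there exists a cost-optimal exploration strategy for T consisting of exactly k(r) walks; together with the lower bound k(r) on the number of walks in any cost-optimal strategy, the minimum number of agents used by a cost-optimal strategy for T equals k(r). -/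

import Mathlib

open SimpleGraph

/-- An exploration strategy on a graph `G` from homebase `h`: a nonempty finite
family of walks, each starting at `h`, that together visit every vertex. -/
structure ExplStrategy {V : Type*} (G : SimpleGraph V) (h : V) where
  k : ℕ
  kpos : 0 < k
  ends : Fin k → V
  walks : (i : Fin k) → G.Walk h (ends i)
  covers : ∀ v : V, ∃ i, v ∈ (walks i).support

/-- The weight of a walk: the sum of the weights of its edges, with multiplicity. -/
def walkWeight {V : Type*} {G : SimpleGraph V} (w : Sym2 V → ℝ) {a b : V}
    (p : G.Walk a b) : ℝ := (p.edges.map w).sum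

/-- Cost of a strategy: `k·q` plus the total distance traversed. -/
noncomputable def stratCost {V : Type*} {G : SimpleGraph V} {h : V}
    (w : Sym2 V → ℝ) (q : ℝ) (S : ExplStrategy G h) : ℝ :=
  (S.k : ℝ) * q + ∑ i, walkWeight w (S.walks i)

/-- A strategy is cost-optimal if no exploration strategy has strictly smaller cost. -/
def IsOptimal {V : Type*} {G : SimpleGraph V} {h : V} (w : Sym2 V → ℝ) (q : ℝ)
    (S : ExplStrategy G h) : Prop :=
  ∀ S' : ExplStrategy G h, stratCost w q S ≤ stratCost w q S'

/-- Weighted distance between two vertices: infimum of weights of connecting walks. -/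
noncomputable def wdist {V : Type*} (G : SimpleGraph V) (w : Sym2 V → ℝ) (u x : V) : ℝ :=
  sInf {c : ℝ | ∃ p : G.Walk u x, walkWeight w p = c}

/-- `u` belongs to the subtree `T_v` of the tree `G` rooted at `r`:
`v` lies on every (equivalently, in a tree, the unique) path from `r` to `u`. -/
def InSubtree {V : Type*} (G : SimpleGraph V) (r v u : V) : Prop :=
  ∀ p : G.Path r u, v ∈ p.1.support

/-- `x` is a leaf of the tree `G` rooted at `r`: a vertex of degree 1 different
from the root. -/
def IsTLeaf {V : Type*} (G : SimpleGraph V) (r x : V) : Prop :=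
  x ≠ r ∧ ∃! y, G.Adj x y

/-- `u` is a child of `v` in the tree `G` rooted at `r`. -/
def IsTChild {V : Type*} (G : SimpleGraph V) (r v u : V) : Prop :=
  G.Adj v u ∧ InSubtree G r v u

open scoped Classical in
/-- Total edge weight of the graph `G`. -/
noncomputable def totalWeight {V : Type*} [Fintype V] (G : SimpleGraph V)
    (w : Sym2 V → ℝ) : ℝ :=
  ∑ e : Sym2 V, if e ∈ G.edgeSet then w e else 0

open scoped Classical in
/-- The set of children of `v` in the tree `G` rooted at `r`, as a finset. -/
noncomputable def childrenFinset {V : Type*} [Fintype V] (G : SimpleGraph V)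
    (r v : V) : Finset V :=
  Finset.univ.filter (fun u => IsTChild G r v u)

open Relation

section RootedTree

variable {V : Type*} {G : SimpleGraph V} {r : V} {w : Sym2 V → ℝ}

@[simp] lemma walkWeight_nil {a : V} : walkWeight w (Walk.nil : G.Walk a a) = 0 := by
  simp [walkWeight]

@[simp] lemma walkWeight_cons {a b c : V} (h : G.Adj a b) (p : G.Walk b c) :
    walkWeight w (Walk.cons h p) = w s(a, b) + walkWeight w p := by
  simp [walkWeight]

@[simp] lemma walkWeight_append {a b c : V} (p : G.Walk a b) (p' : G.Walk b c) :
    walkWeight w (p.append p') = walkWeight w p + walkWeight w p' := by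
  simp [walkWeight]

@[simp] lemma walkWeight_concat {a b c : V} (p : G.Walk a b) (h : G.Adj b c) :
    walkWeight w (p.concat h) = walkWeight w p + w s(b, c) := by
  simp [Walk.concat_eq_append]

/-- The unique path of the tree `G` from `r` to `v`. -/
noncomputable def rootPath (hG : G.IsTree) (r v : V) : G.Walk r v :=
  (hG.existsUnique_path r v).choose

lemma rootPath_isPath (hG : G.IsTree) (r v : V) : (rootPath hG r v).IsPath :=
  (hG.existsUnique_path r v).choose_spec.1

lemma eq_rootPath (hG : G.IsTree) {v : V} {p : G.Walk r v} (hp : p.IsPath) :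
    p = rootPath hG r v :=
  (hG.existsUnique_path r v).unique hp (rootPath_isPath hG r v)

lemma inSubtree_iff_mem_rootPath (hG : G.IsTree) {v u : V} :
    InSubtree G r v u ↔ v ∈ (rootPath hG r u).support :=
  ⟨fun h => h ⟨_, rootPath_isPath hG r u⟩, fun h p => by rwa [eq_rootPath hG p.2]⟩

lemma rootPath_root (hG : G.IsTree) (r : V) : rootPath hG r r = Walk.nil :=
  (eq_rootPath hG Walk.IsPath.nil).symm

lemma IsTChild.rootPath_eq (hG : G.IsTree) {v u : V} (h : IsTChild G r v u) :
    rootPath hG r u = (rootPath hG r v).concat h.1 := by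
  classical
  have hv := (inSubtree_iff_mem_rootPath hG).1 h.2
  have hu := Walk.endpoint_notMem_support_takeUntil (rootPath_isPath hG r u) hv h.1.ne'
  rw [eq_rootPath hG ((rootPath_isPath hG r u).takeUntil hv)] at hu
  exact (eq_rootPath hG ((rootPath_isPath hG r v).concat hu h.1)).symm

lemma isTChild_or_isTChild (hG : G.IsTree) {x y : V} (h : G.Adj x y) :
    IsTChild G r x y ∨ IsTChild G r y x := by
  by_cases hx : x ∈ (rootPath hG r y).support
  · exact Or.inl ⟨h, (inSubtree_iff_mem_rootPath hG).2 hx⟩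
  · refine Or.inr ⟨h.symm, (inSubtree_iff_mem_rootPath hG).2 ?_⟩
    rw [← eq_rootPath hG ((rootPath_isPath hG r y).concat hx h.symm)]
    simp [Walk.support_concat]

lemma IsTChild.length_rootPath (hG : G.IsTree) {v u : V} (h : IsTChild G r v u) :
    (rootPath hG r u).length = (rootPath hG r v).length + 1 := by
  rw [h.rootPath_eq hG, Walk.length_concat]

lemma IsTChild.parent_unique (hG : G.IsTree) {v v' u : V} (h : IsTChild G r v u)
    (h' : IsTChild G r v' u) : v = v' := by
  have := congrArg Walk.penultimate ((h.rootPath_eq hG).symm.trans (h'.rootPath_eq hG))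
  simpa using this

lemma not_isTChild_root (hG : G.IsTree) {v : V} : ¬ IsTChild G r v r := by
  intro h
  have := h.length_rootPath hG
  simp [rootPath_root] at this

lemma exists_parent (hG : G.IsTree) {u : V} (hu : u ≠ r) : ∃ v, IsTChild G r v u := by
  have hnil : ¬ (rootPath hG r u).Nil := fun h => hu h.eq.symm
  exact ⟨_, Walk.adj_penultimate hnil, (inSubtree_iff_mem_rootPath hG).2
    (Walk.getVert_mem_support _ _)⟩

lemma isTChild_wellFounded [Finite V] (hG : G.IsTree) :
    WellFounded (fun u v => IsTChild G r v u) := by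
  cases nonempty_fintype V
  refine Subrelation.wf ?_
    (measure fun v => Fintype.card V - (rootPath hG r v).length).wf
  intro u v h
  have h1 := h.length_rootPath hG
  have h2 := (rootPath_isPath hG r u).length_lt
  change Fintype.card V - _ < Fintype.card V - _
  omega

/-- `u` is a descendant of `v` in the tree `G` rooted at `r`. -/
def IsDesc (G : SimpleGraph V) (r : V) : V → V → Prop := ReflTransGen (IsTChild G r)

lemma isDesc_root_induction (hG : G.IsTree) {P : V → Prop} (root : P r)
    (child : ∀ v u, IsTChild G r v u → P v → P u) (v : V) : P v := by
  induction hn : (rootPath hG r v).length generalizing v with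
  | zero => rwa [← Walk.eq_of_length_eq_zero hn]
  | succ n ih =>
    by_cases hv : v = r
    · rwa [hv]
    · obtain ⟨p, hp⟩ := exists_parent hG hv
      have := hp.length_rootPath hG
      exact child p v hp (ih p (by omega))

lemma isDesc_root (hG : G.IsTree) (v : V) : IsDesc G r r v :=
  isDesc_root_induction hG ReflTransGen.refl (fun _ _ h ih => ih.tail h) v

lemma inSubtree_iff_isDesc (hG : G.IsTree) {v u : V} :
    InSubtree G r v u ↔ IsDesc G r v u := by
  rw [inSubtree_iff_mem_rootPath hG]
  constructor
  · induction u using isDesc_root_induction hG (r := r) with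
    | root =>
      intro h
      rw [rootPath_root] at h
      rw [Walk.support_nil, List.mem_singleton] at h
      exact h ▸ ReflTransGen.refl
    | child p u hp ih =>
      intro h
      rw [hp.rootPath_eq hG, Walk.support_concat, List.mem_append,
        List.mem_singleton] at h
      rcases h with h | rfl
      · exact (ih h).tail hp
      · exact ReflTransGen.refl
  · intro h
    induction h with
    | refl => simp
    | tail _ hc ih =>
      rw [hc.rootPath_eq hG, Walk.support_concat, List.mem_append]
      exact Or.inl ih

lemma IsDesc.eq_root (hG : G.IsTree) {v : V} (h : IsDesc G r v r) : v = r := by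
  rcases ReflTransGen.cases_tail h with h | ⟨c, _, hc⟩
  · exact h.symm
  · exact (not_isTChild_root hG hc).elim

lemma IsDesc.cases_child {v x : V} (h : IsDesc G r v x) :
    x = v ∨ ∃ u, IsTChild G r v u ∧ IsDesc G r u x := by
  rcases ReflTransGen.cases_head h with h | h
  · exact Or.inl h.symm
  · exact Or.inr h

lemma IsDesc.parent (hG : G.IsTree) {v p x : V} (h : IsDesc G r v x) (hx : IsTChild G r p x)
    (hne : x ≠ v) : IsDesc G r v p := by
  rcases ReflTransGen.cases_tail h with h | ⟨c, hc, hcx⟩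
  · exact (hne h).elim
  · exact hx.parent_unique hG hcx ▸ hc

/-- The weighted depth of `v`. -/
noncomputable def wdepth (hG : G.IsTree) (r : V) (w : Sym2 V → ℝ) (v : V) : ℝ :=
  walkWeight w (rootPath hG r v)

lemma wdepth_root (hG : G.IsTree) : wdepth hG r w r = 0 := by
  simp [wdepth, rootPath_root]

lemma IsTChild.wdepth_eq (hG : G.IsTree) {v u : V} (h : IsTChild G r v u) :
    wdepth hG r w u = wdepth hG r w v + w s(v, u) := by
  simp [wdepth, h.rootPath_eq hG]

lemma IsTChild.wdepth_lt (hG : G.IsTree) (hw : ∀ e ∈ G.edgeSet, 0 < w e) {v u : V}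
    (h : IsTChild G r v u) : wdepth hG r w v < wdepth hG r w u := by
  have := hw s(v, u) h.1
  rw [h.wdepth_eq hG]
  linarith

lemma IsDesc.wdepth_le (hG : G.IsTree) (hw : ∀ e ∈ G.edgeSet, 0 < w e) {v u : V}
    (h : IsDesc G r v u) : wdepth hG r w v ≤ wdepth hG r w u := by
  induction h with
  | refl => rfl
  | tail _ hc ih => exact ih.trans (hc.wdepth_lt hG hw).le

lemma wdepth_nonneg (hG : G.IsTree) (hw : ∀ e ∈ G.edgeSet, 0 < w e) (v : V) :
    0 ≤ wdepth hG r w v :=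
  (wdepth_root hG).symm.le.trans ((isDesc_root hG v).wdepth_le hG hw)

lemma wdepth_sub_le_walkWeight (hG : G.IsTree) (hw : ∀ e ∈ G.edgeSet, 0 < w e) {a b : V}
    (p : G.Walk a b) : wdepth hG r w b - wdepth hG r w a ≤ walkWeight w p := by
  induction p with
  | nil => simp
  | @cons a b c h p ih =>
    have := hw s(a, b) h
    rw [walkWeight_cons]
    rcases isTChild_or_isTChild (r := r) hG h with h | h
    · have := h.wdepth_eq hG (w := w)
      linarith
    · have := h.wdepth_lt hG hw
      linarith

lemma wdist_eq (hG : G.IsTree) (hw : ∀ e ∈ G.edgeSet, 0 < w e) {v u : V}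
    (h : IsDesc G r v u) : wdist G w v u = wdepth hG r w u - wdepth hG r w v := by
  refine IsLeast.csInf_eq ⟨?_, ?_⟩
  · induction h with
    | refl => exact ⟨Walk.nil, by simp⟩
    | tail _ hc ih =>
      obtain ⟨p, hp⟩ := ih
      exact ⟨p.concat hc.1, by rw [walkWeight_concat, hp, hc.wdepth_eq hG]; ring⟩
  · rintro c ⟨p, rfl⟩
    exact wdepth_sub_le_walkWeight hG hw p

lemma not_isTChild_of_isTLeaf (hG : G.IsTree) {x u : V} (hx : IsTLeaf G r x) :
    ¬ IsTChild G r x u := by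
  intro h
  obtain ⟨p, hp⟩ := exists_parent hG hx.1
  have := hx.2.unique h.1 hp.1.symm
  subst this
  have h1 := h.length_rootPath hG
  have h2 := hp.length_rootPath hG
  omega

end RootedTree

section Construction

variable {V : Type*} {G : SimpleGraph V} {w : Sym2 V → ℝ}

/-- Some closed walk of weight `c` from `v` visits all of `X`. -/
def Tours (G : SimpleGraph V) (w : Sym2 V → ℝ) (v : V) (X : Set V) (c : ℝ) : Prop :=
  ∃ p : G.Walk v v, (∀ x ∈ X, x ∈ p.support) ∧ walkWeight w p = c

/-- Some family of `n` walks from `v` of total weight `c` visits all of `X`. -/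
def Covers (G : SimpleGraph V) (w : Sym2 V → ℝ) (v : V) (X : Set V) (n : ℕ) (c : ℝ) : Prop :=
  ∃ L : List (Σ e, G.Walk v e), L.length = n ∧ (∀ x ∈ X, ∃ p ∈ L, x ∈ p.2.support) ∧
    (L.map fun p => walkWeight w p.2).sum = c

lemma Tours.children {v : V} {s : Finset V} {X : V → Set V} {c : V → ℝ}
    (h : ∀ u ∈ s, G.Adj v u ∧ Tours G w u (X u) (c u)) :
    Tours G w v (insert v {x | ∃ u ∈ s, x ∈ X u}) (∑ u ∈ s, (c u + 2 * w s(v, u))) := by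
  classical
  induction s using Finset.induction_on with
  | empty => exact ⟨Walk.nil, by simp, by simp⟩
  | insert a s ha ih =>
    obtain ⟨p, hp, hpc⟩ := ih fun u hu => h u (Finset.mem_insert_of_mem hu)
    obtain ⟨hadj, t, ht, htc⟩ := h a (Finset.mem_insert_self a s)
    refine ⟨((Walk.cons hadj t).concat hadj.symm).append p, ?_, ?_⟩
    · rintro x (rfl | ⟨u, hu, hx⟩)
      · simp
      · rw [Walk.mem_support_append_iff]
        rcases Finset.mem_insert.1 hu with rfl | hu
        · left
          rw [Walk.support_concat, Walk.support_cons]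
          simp [ht x hx]
        · exact Or.inr (hp x (Or.inr ⟨u, hu, hx⟩))
    · rw [Finset.sum_insert ha, walkWeight_append, walkWeight_concat, walkWeight_cons, hpc, htc,
        Sym2.eq_swap (a := a)]
      ring

lemma Covers.cons_edge {v u : V} {X : Set V} {n : ℕ} {c : ℝ} (hadj : G.Adj v u)
    (h : Covers G w u X n c) : Covers G w v X n (c + n * w s(v, u)) := by
  obtain ⟨L, hn, hX, hc⟩ := h
  refine ⟨L.map fun p => ⟨p.1, Walk.cons hadj p.2⟩, by simpa using hn, fun x hx => ?_, ?_⟩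
  · obtain ⟨p, hp, hxp⟩ := hX x hx
    exact ⟨_, List.mem_map_of_mem hp, by simp [hxp]⟩
  · subst hn hc
    clear hX
    induction L with
    | nil => simp
    | cons p L ih =>
      simp only [List.map_cons, List.sum_cons, walkWeight_cons, List.length_cons] at ih ⊢
      rw [ih]
      push_cast
      ring

lemma Covers.union {v : V} {X Y : Set V} {n m : ℕ} {c d : ℝ} (h : Covers G w v X n c)
    (h' : Covers G w v Y m d) : Covers G w v (X ∪ Y) (n + m) (c + d) := by
  obtain ⟨L, hn, hX, hc⟩ := h
  obtain ⟨L', hm, hY, hd⟩ := h'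
  refine ⟨L ++ L', by simp [hn, hm], ?_, by simp [hc, hd]⟩
  rintro x (hx | hx)
  · obtain ⟨p, hp, hxp⟩ := hX x hx
    exact ⟨p, by simp [hp], hxp⟩
  · obtain ⟨p, hp, hxp⟩ := hY x hx
    exact ⟨p, by simp [hp], hxp⟩

lemma Covers.mono {v : V} {X Y : Set V} {n : ℕ} {c : ℝ} (h : Covers G w v X n c)
    (hY : Y ⊆ X) : Covers G w v Y n c := by
  obtain ⟨L, hn, hX, hc⟩ := h
  exact ⟨L, hn, fun x hx => hX x (hY hx), hc⟩

lemma Covers.children {v : V} {s : Finset V} {X : V → Set V} {n : V → ℕ} {c : V → ℝ}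
    (h : ∀ u ∈ s, G.Adj v u ∧ Covers G w u (X u) (n u) (c u)) :
    Covers G w v {x | ∃ u ∈ s, x ∈ X u} (∑ u ∈ s, n u)
      (∑ u ∈ s, (c u + n u * w s(v, u))) := by
  classical
  induction s using Finset.induction_on with
  | empty => exact ⟨[], by simp, by simp, by simp⟩
  | insert a s ha ih =>
    obtain ⟨hadj, h'⟩ := h a (Finset.mem_insert_self a s)
    rw [Finset.sum_insert ha, Finset.sum_insert ha]
    refine ((h'.cons_edge hadj).union
      (ih fun u hu => h u (Finset.mem_insert_of_mem hu))).mono ?_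
    rintro x ⟨u, hu, hx⟩
    rcases Finset.mem_insert.1 hu with rfl | hu
    · exact Or.inl hx
    · exact Or.inr ⟨u, hu, hx⟩

lemma Covers.union_tour {v : V} {X Y : Set V} {n : ℕ} {c d : ℝ} (hn : n ≠ 0)
    (h : Covers G w v X n c) (h' : Tours G w v Y d) : Covers G w v (X ∪ Y) n (c + d) := by
  obtain ⟨L, hL, hX, hc⟩ := h
  obtain ⟨t, ht, htd⟩ := h'
  cases L with
  | nil => exact (hn hL.symm).elim
  | cons p L =>
    refine ⟨⟨p.1, t.append p.2⟩ :: L, by simpa using hL, ?_, ?_⟩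
    · rintro x (hx | hx)
      · obtain ⟨p', hp', hxp⟩ := hX x hx
        rcases List.mem_cons.1 hp' with rfl | hp'
        · exact ⟨_, List.mem_cons_self, by simp [Walk.mem_support_append_iff, hxp]⟩
        · exact ⟨p', List.mem_cons_of_mem _ hp', hxp⟩
      · exact ⟨_, List.mem_cons_self, by simp [Walk.mem_support_append_iff, ht x hx]⟩
    · simp only [List.map_cons, List.sum_cons, walkWeight_append] at hc ⊢
      linarith

lemma Covers.exists_strategy {h : V} {n : ℕ} {c : ℝ} (hn : n ≠ 0)
    (hc : Covers G w h Set.univ n c) (q : ℝ) :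
    ∃ S : ExplStrategy G h, S.k = n ∧ stratCost w q S = n * q + c := by
  obtain ⟨L, rfl, hX, rfl⟩ := hc
  refine ⟨⟨L.length, Nat.pos_of_ne_zero hn, fun i => L[i].1, fun i => L[i].2, fun v => ?_⟩,
    rfl, ?_⟩
  · obtain ⟨p, hp, hv⟩ := hX v (Set.mem_univ v)
    obtain ⟨i, hi, rfl⟩ := List.mem_iff_getElem.1 hp
    exact ⟨⟨i, hi⟩, hv⟩
  · rw [stratCost, ← Fin.sum_univ_fun_getElem]
    rfl

end Construction

section Labeling

variable {V : Type*} {G : SimpleGraph V} {r : V} {w : Sym2 V → ℝ} {q : ℝ}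
  {f : V → V} {k : V → ℕ}

open scoped Classical in
/-- The contribution `κ(u)` of the child `u` of `v` to the label of `v`, where `f u` is a furthest
leaf below `u`. -/
noncomputable def contribution (hG : G.IsTree) (r : V) (w : Sym2 V → ℝ) (q : ℝ) (f : V → V)
    (k : V → ℕ) (v u : V) : ℕ :=
  if k u = 1 ∧ wdepth hG r w (f u) - wdepth hG r w v ≤ wdepth hG r w v + q then 0 else k u

lemma contribution_ne_zero {hG : G.IsTree} {v u : V}
    (hu : contribution hG r w q f k v u ≠ 0) : contribution hG r w q f k v u = k u := by
  unfold contribution at hu ⊢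
  split_ifs at hu ⊢ with hc
  · exact (hu rfl).elim
  · rfl

variable [Fintype V]

lemma mem_childrenFinset {v u : V} : u ∈ childrenFinset G r v ↔ IsTChild G r v u := by
  simp [childrenFinset]

lemma exists_children_recursion (hG : G.IsTree) (A : V → Prop) [DecidablePred A] (a : V → ℝ)
    (b : V → V → ℝ → ℝ) :
    ∃ g : V → ℝ, ∀ v, g v = if A v then a v else ∑ u ∈ childrenFinset G r v, b v u (g u) := by
  refine ⟨(isTChild_wellFounded hG (r := r)).fix fun v rec => if A v then a v else
    ∑ u ∈ (childrenFinset G r v).attach, b v u (rec u (mem_childrenFinset.1 u.2)), fun v => ?_⟩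
  rw [WellFounded.fix_eq, ← Finset.sum_attach (childrenFinset G r v)]

/-- `f` selects a furthest leaf in every subtree and `k` satisfies the labeling recursion. -/
structure IsLabeling (hG : G.IsTree) (r : V) (w : Sym2 V → ℝ) (q : ℝ) (f : V → V)
    (k : V → ℕ) : Prop where
  isDesc : ∀ v, IsDesc G r v (f v)
  mono : ∀ v u, IsTChild G r v u → wdepth hG r w (f u) ≤ wdepth hG r w (f v)
  attained : ∀ v u, IsTChild G r v u →
    ∃ u', IsTChild G r v u' ∧ wdepth hG r w (f u') = wdepth hG r w (f v)
  label_eq : ∀ v, k v = max 1 (∑ u ∈ childrenFinset G r v, contribution hG r w q f k v u)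

/-- `g v` is the largest saving, compared to touring `T_v` once and returning, achieved by a
nonempty group of agents that end inside `T_v`. -/
def IsGain (hG : G.IsTree) (r : V) (w : Sym2 V → ℝ) (q : ℝ) (f : V → V)
    (k : V → ℕ) (g : V → ℝ) : Prop :=
  ∀ v, g v = if k v = 1 then wdepth hG r w (f v) - wdepth hG r w v - (wdepth hG r w v + q)
    else ∑ u ∈ childrenFinset G r v, max 0 (g u + 2 * w s(v, u))

lemma IsLabeling.one_le {hG : G.IsTree} (hk : IsLabeling hG r w q f k) (v : V) : 1 ≤ k v := by
  rw [hk.label_eq]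
  exact le_max_left _ _

lemma IsGain.nonpos {hG : G.IsTree} {g : V → ℝ} (hg : IsGain hG r w q f k g)
    (hk : IsLabeling hG r w q f k) {v u : V} (h : IsTChild G r v u)
    (hu : contribution hG r w q f k v u = 0) : g u + 2 * w s(v, u) ≤ 0 := by
  unfold contribution at hu
  split_ifs at hu with hc
  · rw [hg, if_pos hc.1]
    have := h.wdepth_eq hG (w := w)
    linarith [hc.2]
  · have := hk.one_le u
    omega

lemma IsGain.pos {hG : G.IsTree} (hw : ∀ e ∈ G.edgeSet, 0 < w e) {g : V → ℝ}
    (hg : IsGain hG r w q f k g) {v u : V} (h : IsTChild G r v u)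
    (hu : contribution hG r w q f k v u ≠ 0) : 0 < g u + 2 * w s(v, u) := by
  unfold contribution at hu
  split_ifs at hu with hc
  · exact (hu rfl).elim
  · rw [hg]
    have := h.wdepth_eq hG (w := w)
    split_ifs with h1
    · have := not_le.1 fun h2 => hc ⟨h1, h2⟩
      linarith
    · have : 0 ≤ ∑ x ∈ childrenFinset G r u, max 0 (g x + 2 * w s(u, x)) :=
        Finset.sum_nonneg fun _ _ => le_max_left _ _
      have := hw s(v, u) h.1
      linarith

lemma eq_one_of_contribution_eq_zero {hG : G.IsTree} (hk : IsLabeling hG r w q f k) {v u : V}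
    (hu : contribution hG r w q f k v u = 0) : k u = 1 := by
  unfold contribution at hu
  split_ifs at hu with hc
  · exact hc.1
  · have := hk.one_le u
    omega

lemma exists_dominant_child {hG : G.IsTree} (hk : IsLabeling hG r w q f k) {v : V}
    (hv : k v = 1) {B : Finset V} (hB : B ⊆ childrenFinset G r v) (hne : B.Nonempty) :
    ∃ u ∈ B, k u = 1 ∧ ∀ x ∈ B, x ≠ u → contribution hG r w q f k v x = 0 := by
  classical
  have hsum : ∑ u ∈ childrenFinset G r v, contribution hG r w q f k v u ≤ 1 := by
    rw [← hv, hk.label_eq v]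
    exact le_max_right _ _
  by_cases h : ∃ u ∈ B, contribution hG r w q f k v u ≠ 0
  · obtain ⟨u, huB, hu⟩ := h
    rw [← Finset.add_sum_erase _ _ (hB huB)] at hsum
    refine ⟨u, huB, ?_, fun x hx hxu => ?_⟩
    · have := hk.one_le u
      have := contribution_ne_zero hu
      omega
    · have := Finset.single_le_sum (f := contribution hG r w q f k v) (fun _ _ => Nat.zero_le _)
        (Finset.mem_erase.2 ⟨hxu, hB hx⟩)
      omega
  · push Not at h
    obtain ⟨u, hu⟩ := hne
    exact ⟨u, hu, eq_one_of_contribution_eq_zero hk (h u hu), fun x hx _ => h x hx⟩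

lemma IsGain.sum_le {hG : G.IsTree} (hw : ∀ e ∈ G.edgeSet, 0 < w e) (hq : 0 ≤ q) {g : V → ℝ}
    (hg : IsGain hG r w q f k g) (hk : IsLabeling hG r w q f k) {v : V} {B : Finset V}
    (hB : B ⊆ childrenFinset G r v) {s : ℝ} (hs : 0 ≤ s) (hsB : B = ∅ → 1 ≤ s) :
    ∑ u ∈ B, (g u + 2 * w s(v, u)) ≤ g v + s * (wdepth hG r w v + q) := by
  classical
  have hD := wdepth_nonneg hG (r := r) hw v
  rcases B.eq_empty_or_nonempty with rfl | hne
  · rw [Finset.sum_empty]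
    have h1 : 1 * (wdepth hG r w v + q) ≤ s * (wdepth hG r w v + q) :=
      mul_le_mul_of_nonneg_right (hsB rfl) (by linarith)
    rw [hg]
    split_ifs with h
    · have := (hk.isDesc v).wdepth_le hG hw
      linarith
    · have : 0 ≤ ∑ x ∈ childrenFinset G r v, max 0 (g x + 2 * w s(v, x)) :=
        Finset.sum_nonneg fun _ _ => le_max_left _ _
      linarith
  · have h1 : 0 ≤ s * (wdepth hG r w v + q) := mul_nonneg hs (by linarith)
    refine le_trans ?_ (le_add_of_nonneg_right h1)
    rw [hg v]
    split_ifs with h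
    · obtain ⟨u, huB, hu, hx⟩ := exists_dominant_child hk h hB hne
      have huv := mem_childrenFinset.1 (hB huB)
      rw [← Finset.add_sum_erase _ _ huB]
      have h2 : ∑ x ∈ B.erase u, (g x + 2 * w s(v, x)) ≤ 0 :=
        Finset.sum_nonpos fun x hxB => hg.nonpos hk
          (mem_childrenFinset.1 (hB (Finset.mem_of_mem_erase hxB)))
          (hx x (Finset.mem_of_mem_erase hxB) (Finset.ne_of_mem_erase hxB))
      have h3 := hg u
      rw [if_pos hu] at h3
      have h4 := huv.wdepth_eq hG (w := w)
      have h5 := hk.mono v u huv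
      linarith
    · exact (Finset.sum_le_sum fun _ _ => le_max_right _ _).trans
        (Finset.sum_le_sum_of_subset_of_nonneg hB fun _ _ _ => le_max_left _ _)

variable {W : V → ℝ}

lemma tours_subtree (hG : G.IsTree)
    (hW : ∀ v, W v = ∑ u ∈ childrenFinset G r v, (W u + w s(v, u))) (v : V) :
    Tours G w v {x | IsDesc G r v x} (2 * W v) := by
  induction v using (isTChild_wellFounded hG (r := r)).induction with
  | _ v ih =>
    obtain ⟨p, hp, hc⟩ := Tours.children (s := childrenFinset G r v) fun u hu =>
      ⟨(mem_childrenFinset.1 hu).1, ih u (mem_childrenFinset.1 hu)⟩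
    refine ⟨p, fun x hx => hp x ?_, ?_⟩
    · rcases IsDesc.cases_child hx with rfl | ⟨u, hu, hux⟩
      · exact Or.inl rfl
      · exact Or.inr ⟨u, mem_childrenFinset.2 hu, hux⟩
    · rw [hc, hW v, Finset.mul_sum]
      exact Finset.sum_congr rfl fun _ _ => by ring

lemma covers_subtree_one {hG : G.IsTree} (hk : IsLabeling hG r w q f k)
    (hW : ∀ v, W v = ∑ u ∈ childrenFinset G r v, (W u + w s(v, u))) (v : V) :
    Covers G w v {x | IsDesc G r v x} 1
      (2 * W v - (wdepth hG r w (f v) - wdepth hG r w v)) := by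
  classical
  induction v using (isTChild_wellFounded hG (r := r)).induction with
  | _ v ih =>
    by_cases h : ∃ u, IsTChild G r v u
    · obtain ⟨u, hu⟩ := h
      obtain ⟨u, hu, hfu⟩ := hk.attained v u hu
      have h1 := ((ih u hu).cons_edge hu.1).union_tour one_ne_zero
        (Tours.children (s := (childrenFinset G r v).erase u) fun x hx =>
          have hx' := mem_childrenFinset.1 (Finset.mem_of_mem_erase hx)
          ⟨hx'.1, tours_subtree hG hW x⟩)
      convert h1.mono (Y := {x | IsDesc G r v x}) ?_ using 1
      · rw [hW v, ← Finset.add_sum_erase _ _ (mem_childrenFinset.2 hu), ← hfu,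
          hu.wdepth_eq hG, mul_add, Finset.mul_sum]
        rw [Finset.sum_congr rfl fun x _ => mul_add 2 (W x) (w s(v, x))]
        push_cast
        ring
      · intro x hx
        rcases IsDesc.cases_child hx with rfl | ⟨y, hy, hyx⟩
        · exact Or.inr (Or.inl rfl)
        · by_cases hyu : y = u
          · exact Or.inl (hyu ▸ hyx)
          · exact Or.inr (Or.inr ⟨y, Finset.mem_erase.2 ⟨hyu, mem_childrenFinset.2 hy⟩, hyx⟩)
    · have hdesc : ∀ x, IsDesc G r v x → x = v := fun x hx =>
        hx.cases_child.resolve_right fun ⟨u, hu, _⟩ => h ⟨u, hu⟩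
      have h0 : childrenFinset G r v = ∅ :=
        Finset.eq_empty_of_forall_notMem fun u hu => h ⟨u, mem_childrenFinset.1 hu⟩
      refine ⟨[⟨v, Walk.nil⟩], rfl, fun x hx => ⟨_, List.mem_singleton_self _, ?_⟩, ?_⟩
      · simp [hdesc x hx]
      · rw [hdesc _ (hk.isDesc v), hW, h0]
        simp

lemma covers_subtree_label {hG : G.IsTree} (hw : ∀ e ∈ G.edgeSet, 0 < w e) {g : V → ℝ}
    (hg : IsGain hG r w q f k g) (hk : IsLabeling hG r w q f k)
    (hW : ∀ v, W v = ∑ u ∈ childrenFinset G r v, (W u + w s(v, u))) (v : V) :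
    Covers G w v {x | IsDesc G r v x} (k v)
      (2 * W v - g v - k v * (wdepth hG r w v + q)) := by
  classical
  induction v using (isTChild_wellFounded hG (r := r)).induction with
  | _ v ih =>
    by_cases h : k v = 1
    · convert covers_subtree_one hk hW v using 1
      rw [hg v, if_pos h, h]
      push_cast
      ring
    · set κ := contribution hG r w q f k v with hκ
      have hkv : k v = ∑ u ∈ childrenFinset G r v, κ u := by
        have h1 : k v = max 1 (∑ u ∈ childrenFinset G r v, κ u) := hk.label_eq v
        have h2 := hk.one_le v
        omega
      set s := (childrenFinset G r v).filter fun u => κ u ≠ 0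
      set t := (childrenFinset G r v).filter fun u => ¬ κ u ≠ 0
      have hs : ∀ u ∈ s, IsTChild G r v u ∧ κ u ≠ 0 := fun u hu =>
        ⟨mem_childrenFinset.1 (Finset.mem_filter.1 hu).1, (Finset.mem_filter.1 hu).2⟩
      have ht : ∀ u ∈ t, IsTChild G r v u ∧ κ u = 0 := fun u hu =>
        ⟨mem_childrenFinset.1 (Finset.mem_filter.1 hu).1,
          not_not.1 (Finset.mem_filter.1 hu).2⟩
      have hks : k v = ∑ u ∈ s, k u := by
        rw [hkv, Finset.sum_filter]
        refine Finset.sum_congr rfl fun u _ => ?_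
        split_ifs with hu
        · exact contribution_ne_zero hu
        · exact not_not.1 hu
      have hsplit : ∀ F : V → ℝ,
          ∑ u ∈ childrenFinset G r v, F u = ∑ u ∈ s, F u + ∑ u ∈ t, F u := fun F =>
        (Finset.sum_filter_add_sum_filter_not _ _ _).symm
      have h1 := Covers.children (s := s) fun u hu => ⟨(hs u hu).1.1, ih u (hs u hu).1⟩
      have h2 := Tours.children (s := t) fun u hu =>
        ⟨(ht u hu).1.1, tours_subtree hG hW u⟩
      rw [← hks] at h1
      have h3 := h1.union_tour (by have := hk.one_le v; omega) h2
      convert h3.mono (Y := {x | IsDesc G r v x}) ?_ using 1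
      · rw [hW v, hg v, if_neg h, hsplit, hsplit, hks]
        have e1 : ∑ u ∈ t, max 0 (g u + 2 * w s(v, u)) = 0 :=
          Finset.sum_eq_zero fun u hu => max_eq_left (hg.nonpos hk (ht u hu).1 (ht u hu).2)
        have e2 : ∑ u ∈ s, max 0 (g u + 2 * w s(v, u)) = ∑ u ∈ s, (g u + 2 * w s(v, u)) :=
          Finset.sum_congr rfl fun u hu => max_eq_right (hg.pos hw (hs u hu).1 (hs u hu).2).le
        have e3 : ∑ u ∈ s, (2 * W u - g u - k u * (wdepth hG r w u + q) + k u * w s(v, u)) =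
            ∑ u ∈ s, (2 * (W u + w s(v, u)) - (g u + 2 * w s(v, u))
              - k u * (wdepth hG r w v + q)) :=
          Finset.sum_congr rfl fun u hu => by rw [(hs u hu).1.wdepth_eq hG]; ring
        have e4 : ∑ u ∈ t, (2 * W u + 2 * w s(v, u)) = ∑ u ∈ t, 2 * (W u + w s(v, u)) :=
          Finset.sum_congr rfl fun u _ => by ring
        rw [e1, e2, e3, e4, Finset.sum_sub_distrib, Finset.sum_sub_distrib, ← Finset.mul_sum,
          ← Finset.mul_sum, ← Finset.sum_mul]
        push_cast
        ring
      · intro x hx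
        rcases IsDesc.cases_child hx with rfl | ⟨y, hy, hyx⟩
        · exact Or.inr (Or.inl rfl)
        · by_cases hy0 : κ y ≠ 0
          · exact Or.inl ⟨y, Finset.mem_filter.2 ⟨mem_childrenFinset.2 hy, hy0⟩, hyx⟩
          · exact Or.inr (Or.inr ⟨y, Finset.mem_filter.2 ⟨mem_childrenFinset.2 hy, hy0⟩, hyx⟩)

lemma exists_strategy_label {hG : G.IsTree} (hw : ∀ e ∈ G.edgeSet, 0 < w e) {g : V → ℝ}
    (hg : IsGain hG r w q f k g) (hk : IsLabeling hG r w q f k)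
    (hW : ∀ v, W v = ∑ u ∈ childrenFinset G r v, (W u + w s(v, u))) :
    ∃ S : ExplStrategy G r, S.k = k r ∧ stratCost w q S = 2 * W r - g r := by
  have h := (covers_subtree_label hw hg hk hW r).mono (Y := Set.univ) fun x _ => isDesc_root hG x
  obtain ⟨S, hS, hc⟩ := h.exists_strategy (by have := hk.one_le r; omega) q
  refine ⟨S, hS, ?_⟩
  rw [hc, wdepth_root]
  ring

end Labeling

section LowerBound

variable {V : Type*} {G : SimpleGraph V} {r : V} {w : Sym2 V → ℝ} {q : ℝ}
  {f : V → V} {k : V → ℕ}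

lemma mem_edges_of_isDesc_iff_not (hG : G.IsTree) {v u : V} (h : IsTChild G r v u) {a b : V}
    (p : G.Walk a b) (hab : IsDesc G r u a ↔ ¬ IsDesc G r u b) : s(v, u) ∈ p.edges := by
  induction p with
  | nil => exact (iff_not_self hab).elim
  | @cons a c b hac p ih =>
    rw [Walk.edges_cons, List.mem_cons]
    by_cases hc : IsDesc G r u a ↔ IsDesc G r u c
    · exact Or.inr (ih (hc.symm.trans hab))
    · left
      rcases isTChild_or_isTChild (r := r) hG hac with h' | h'
      · have hu : IsDesc G r u c ∧ ¬ IsDesc G r u a := by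
          have : IsDesc G r u a → IsDesc G r u c := fun h => h.tail h'
          tauto
        have : c = u := by
          by_contra hne
          exact hu.2 (hu.1.parent hG h' hne)
        subst this
        rw [h.parent_unique hG h']
      · have hu : IsDesc G r u a ∧ ¬ IsDesc G r u c := by
          have : IsDesc G r u c → IsDesc G r u a := fun h => h.tail h'
          tauto
        have : a = u := by
          by_contra hne
          exact hu.2 (hu.1.parent hG h' hne)
        subst this
        rw [h.parent_unique hG h', Sym2.eq_swap]

lemma IsTChild.not_isDesc_root (hG : G.IsTree) {v u : V} (h : IsTChild G r v u) :
    ¬ IsDesc G r u r := fun hd => not_isTChild_root hG (hd.eq_root hG ▸ h)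

lemma one_le_count_edges [DecidableEq V] (hG : G.IsTree) {v u e : V} (h : IsTChild G r v u)
    (p : G.Walk r e) (he : IsDesc G r u e) : 1 ≤ p.edges.count s(v, u) :=
  List.count_pos_iff.2 <| mem_edges_of_isDesc_iff_not hG h p <|
    iff_of_false (h.not_isDesc_root hG) (not_not.2 he)

lemma two_le_count_edges [DecidableEq V] (hG : G.IsTree) {v u e : V} (h : IsTChild G r v u)
    (p : G.Walk r e) (hu : u ∈ p.support) (he : ¬ IsDesc G r u e) :
    2 ≤ p.edges.count s(v, u) := by
  have h1 := one_le_count_edges hG h (p.takeUntil u hu) ReflTransGen.refl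
  have h2 : 1 ≤ (p.dropUntil u hu).edges.count s(v, u) :=
    List.count_pos_iff.2 <| mem_edges_of_isDesc_iff_not hG h _ <|
      iff_of_true ReflTransGen.refl he
  rw [← p.take_spec hu, Walk.edges_append, List.count_append]
  omega

variable [Fintype V]

lemma sum_sum_children (hG : G.IsTree) (F : V → ℝ) :
    ∑ v, ∑ u ∈ childrenFinset G r v, F u + F r = ∑ v, F v := by
  classical
  rw [← Finset.sum_erase_add Finset.univ F (Finset.mem_univ r), Finset.sum_sigma']
  congr 1
  refine Finset.sum_nbij (fun x => x.2) ?_ ?_ ?_ fun _ _ => rfl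
  · rintro ⟨v, u⟩ h
    have h := mem_childrenFinset.1 (Finset.mem_sigma.1 h).2
    exact Finset.mem_erase.2 ⟨fun hu => not_isTChild_root hG (hu ▸ h), Finset.mem_univ _⟩
  · rintro ⟨v, u⟩ h ⟨v', u'⟩ h' (rfl : u = u')
    have : v = v' := (mem_childrenFinset.1 (Finset.mem_sigma.1 h).2).parent_unique hG
      (mem_childrenFinset.1 (Finset.mem_sigma.1 h').2)
    rw [this]
  · intro u hu
    obtain ⟨v, hv⟩ := exists_parent hG (Finset.ne_of_mem_erase hu)
    exact ⟨⟨v, u⟩, Finset.mem_sigma.2 ⟨Finset.mem_univ _, mem_childrenFinset.2 hv⟩, rfl⟩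

lemma sum_count_le_walkWeight [DecidableEq V] (hG : G.IsTree) (hw : ∀ e ∈ G.edgeSet, 0 < w e)
    {a b : V} (p : G.Walk a b) :
    ∑ v, ∑ u ∈ childrenFinset G r v, p.edges.count s(v, u) * w s(v, u) ≤ walkWeight w p := by
  have h0 : walkWeight w p = ∑ e, p.edges.count e * w e := by
    rw [walkWeight, Finset.sum_list_map_count]
    simp only [nsmul_eq_mul]
    refine Finset.sum_subset (Finset.subset_univ _) fun e _ he => ?_
    rw [List.count_eq_zero_of_not_mem fun h => he (List.mem_toFinset.2 h)]
    simp
  have hinj : Set.InjOn (fun x : Σ _ : V, V => s(x.1, x.2))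
      (Finset.univ.sigma (childrenFinset G r) : Finset (Σ _ : V, V)) := by
    rintro ⟨v, u⟩ h ⟨v', u'⟩ h' heq
    have h := mem_childrenFinset.1 (Finset.mem_sigma.1 h).2
    have h' := mem_childrenFinset.1 (Finset.mem_sigma.1 h').2
    rcases Sym2.eq_iff.1 heq with ⟨h1, h2⟩ | ⟨h1, h2⟩
    · simp only at h1 h2
      rw [h1, h2]
    · simp only at h1 h2 h h'
      subst h1 h2
      have := h.length_rootPath hG
      have := h'.length_rootPath hG
      omega
  rw [h0, Finset.sum_sigma', ← Finset.sum_image (f := fun e => (p.edges.count e : ℝ) * w e) hinj]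
  refine Finset.sum_le_sum_of_subset_of_nonneg (Finset.subset_univ _) fun e _ _ => ?_
  by_cases he : e ∈ p.edges
  · exact mul_nonneg (Nat.cast_nonneg _) (hw e (p.edges_subset_edgeSet he)).le
  · rw [List.count_eq_zero_of_not_mem he]
    simp

open scoped Classical in
lemma wdepth_eq_sum (hG : G.IsTree) (hw : ∀ e ∈ G.edgeSet, 0 < w e) (x : V) :
    wdepth hG r w x =
      ∑ v, ∑ u ∈ childrenFinset G r v, (if IsDesc G r u x then 1 else 0) * w s(v, u) := by
  induction x using isDesc_root_induction hG (r := r) with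
  | root =>
    rw [wdepth_root]
    refine (Finset.sum_eq_zero fun v _ => Finset.sum_eq_zero fun u hu => ?_).symm
    rw [if_neg ((mem_childrenFinset.1 hu).not_isDesc_root hG), zero_mul]
  | child p x hp ih =>
    have h1 : ∀ u, ((if IsDesc G r u x then 1 else 0 : ℝ)) =
        (if IsDesc G r u p then 1 else 0) + if u = x then 1 else 0 := by
      intro u
      by_cases hux : u = x
      · subst hux
        have : ¬ IsDesc G r u p := fun h =>
          absurd (h.wdepth_le hG hw) (not_le.2 (hp.wdepth_lt hG hw))
        rw [if_pos (show IsDesc G r u u from ReflTransGen.refl), if_neg this, if_pos rfl, zero_add]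
      · have : IsDesc G r u x ↔ IsDesc G r u p :=
          ⟨fun h => h.parent hG hp (Ne.symm hux), fun h => h.tail hp⟩
        simp [hux, this]
    have h2 : ∑ v, ∑ u ∈ childrenFinset G r v, (if u = x then 1 else 0) * w s(v, u) =
        w s(p, x) := by
      rw [Finset.sum_eq_single_of_mem p (Finset.mem_univ p),
        Finset.sum_eq_single_of_mem x (mem_childrenFinset.2 hp)]
      · simp
      · intro u _ hu
        simp [hu]
      · intro v _ hv
        refine Finset.sum_eq_zero fun u hu => ?_
        rw [if_neg, zero_mul]
        rintro rfl
        exact hv ((mem_childrenFinset.1 hu).parent_unique hG hp)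
    rw [hp.wdepth_eq hG, ih, ← h2, ← Finset.sum_add_distrib]
    refine Finset.sum_congr rfl fun v _ => ?_
    rw [← Finset.sum_add_distrib]
    exact Finset.sum_congr rfl fun u _ => by rw [h1 u, add_mul]

open scoped Classical in
lemma le_stratCost (hG : G.IsTree) (hw : ∀ e ∈ G.edgeSet, 0 < w e) (S : ExplStrategy G r) :
    ∑ i, (wdepth hG r w (S.ends i) + q) + ∑ v, ∑ u ∈ childrenFinset G r v,
      (if ∃ i, IsDesc G r u (S.ends i) then 0 else 2 * w s(v, u)) ≤ stratCost w q S := by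
  have h1 : ∑ v, ∑ u ∈ childrenFinset G r v,
      (∑ i, ((S.walks i).edges.count s(v, u) : ℝ)) * w s(v, u) ≤
        ∑ i, walkWeight w (S.walks i) := by
    refine le_trans (le_of_eq ?_)
      (Finset.sum_le_sum fun i _ => sum_count_le_walkWeight (r := r) hG hw (S.walks i))
    rw [Finset.sum_comm]
    refine Finset.sum_congr rfl fun v _ => ?_
    rw [Finset.sum_comm]
    exact Finset.sum_congr rfl fun u _ => Finset.sum_mul _ _ _
  have h2 : ∑ i, wdepth hG r w (S.ends i) = ∑ v, ∑ u ∈ childrenFinset G r v,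
      (∑ i, (if IsDesc G r u (S.ends i) then 1 else 0 : ℝ)) * w s(v, u) := by
    rw [Finset.sum_congr rfl fun i _ => wdepth_eq_sum hG hw (S.ends i), Finset.sum_comm]
    refine Finset.sum_congr rfl fun v _ => ?_
    rw [Finset.sum_comm]
    exact Finset.sum_congr rfl fun u _ => (Finset.sum_mul _ _ _).symm
  have h3 : ∀ v, ∀ u ∈ childrenFinset G r v,
      (∑ i, (if IsDesc G r u (S.ends i) then 1 else 0 : ℝ)) * w s(v, u) +
        (if ∃ i, IsDesc G r u (S.ends i) then 0 else 2 * w s(v, u)) ≤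
      (∑ i, ((S.walks i).edges.count s(v, u) : ℝ)) * w s(v, u) := by
    intro v u hu
    have hc := mem_childrenFinset.1 hu
    have hwe := (hw s(v, u) hc.1).le
    split_ifs with h
    · rw [add_zero]
      refine mul_le_mul_of_nonneg_right (Finset.sum_le_sum fun i _ => ?_) hwe
      split_ifs with hi
      · exact_mod_cast one_le_count_edges hG hc (S.walks i) hi
      · positivity
    · push Not at h
      rw [Finset.sum_eq_zero fun i _ => if_neg (h i), zero_mul, zero_add]
      refine mul_le_mul_of_nonneg_right ?_ hwe
      obtain ⟨i, hi⟩ := S.covers u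
      have := two_le_count_edges hG hc (S.walks i) hi (h i)
      exact le_trans (by exact_mod_cast this) (Finset.single_le_sum
        (f := fun i => ((S.walks i).edges.count s(v, u) : ℝ))
        (fun _ _ => Nat.cast_nonneg _) (Finset.mem_univ i))
  have h4 := Finset.sum_le_sum fun v (_ : v ∈ Finset.univ) => Finset.sum_le_sum (h3 v)
  simp only [Finset.sum_add_distrib] at h4
  rw [stratCost, Finset.sum_add_distrib, h2]
  simp only [Finset.sum_const, Finset.card_univ, Fintype.card_fin, nsmul_eq_mul]
  linarith

lemma IsGain.le_stratCost {hG : G.IsTree} (hw : ∀ e ∈ G.edgeSet, 0 < w e) (hq : 0 ≤ q)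
    {g : V → ℝ} (hg : IsGain hG r w q f k g) (hk : IsLabeling hG r w q f k) {W : V → ℝ}
    (hW : ∀ v, W v = ∑ u ∈ childrenFinset G r v, (W u + w s(v, u))) (S : ExplStrategy G r) :
    2 * W r - g r ≤ stratCost w q S := by
  classical
  set P : V → Prop := fun v => ∃ i, IsDesc G r v (S.ends i) with hP
  have hlocal : ∀ v, ∑ u ∈ childrenFinset G r v, (if P u then g u + 2 * w s(v, u) else 0) ≤
      (if P v then g v else 0) +
        (∑ i, (if S.ends i = v then 1 else 0 : ℝ)) * (wdepth hG r w v + q) := by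
    intro v
    have hs : 0 ≤ ∑ i, (if S.ends i = v then 1 else 0 : ℝ) :=
      Finset.sum_nonneg fun i _ => by split_ifs <;> norm_num
    have hD := wdepth_nonneg hG (r := r) hw v
    rw [← Finset.sum_filter]
    split_ifs with hv
    · refine hg.sum_le hw hq hk (Finset.filter_subset _ _) hs fun hB => ?_
      obtain ⟨i, hi⟩ := hv
      rcases hi.cases_child with hi | ⟨u, hu, hui⟩
      · refine le_trans ?_ (Finset.single_le_sum
          (f := fun i => (if S.ends i = v then 1 else 0 : ℝ))
          (fun i _ => by split_ifs <;> norm_num) (Finset.mem_univ i))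
        simp [hi]
      · have : u ∈ (∅ : Finset V) :=
          hB ▸ Finset.mem_filter.2 ⟨mem_childrenFinset.2 hu, i, hui⟩
        simp at this
    · rw [Finset.filter_eq_empty_iff.2, Finset.sum_empty]
      · have := mul_nonneg hs (add_nonneg hD hq)
        linarith
      · rintro u hu ⟨i, hi⟩
        exact hv ⟨i, ReflTransGen.head (mem_childrenFinset.1 hu) hi⟩
  have hPr : P r := ⟨⟨0, S.kpos⟩, isDesc_root hG _⟩
  have hsum := Finset.sum_le_sum fun v (_ : v ∈ Finset.univ) => hlocal v
  have hends : ∑ v, (∑ i, (if S.ends i = v then 1 else 0 : ℝ)) * (wdepth hG r w v + q) =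
      ∑ i, (wdepth hG r w (S.ends i) + q) := by
    simp only [Finset.sum_mul]
    rw [Finset.sum_comm]
    simp
  have hgP := sum_sum_children (r := r) hG fun v => if P v then g v else 0
  rw [if_pos hPr] at hgP
  have hWr : W r = ∑ v, ∑ u ∈ childrenFinset G r v, w s(v, u) := by
    have h1 := sum_sum_children (r := r) hG W
    have h2 := Finset.sum_congr rfl fun v (_ : v ∈ Finset.univ) => hW v
    simp only [Finset.sum_add_distrib] at h2
    linarith
  have hsplit : ∑ v, ∑ u ∈ childrenFinset G r v, (if P u then g u + 2 * w s(v, u) else 0) +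
      ∑ v, ∑ u ∈ childrenFinset G r v, (if P u then 0 else 2 * w s(v, u)) =
      ∑ v, ∑ u ∈ childrenFinset G r v, (if P u then g u else 0) + 2 * W r := by
    rw [hWr, Finset.mul_sum, ← Finset.sum_add_distrib, ← Finset.sum_add_distrib]
    refine Finset.sum_congr rfl fun v _ => ?_
    rw [Finset.mul_sum, ← Finset.sum_add_distrib, ← Finset.sum_add_distrib]
    refine Finset.sum_congr rfl fun u _ => ?_
    split_ifs <;> ring
  have hcost := _root_.le_stratCost (q := q) hG hw S
  rw [Finset.sum_add_distrib, hends] at hsum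
  linarith

lemma IsLabeling.exists_isOptimal {hG : G.IsTree} (hw : ∀ e ∈ G.edgeSet, 0 < w e) (hq : 0 ≤ q)
    (hk : IsLabeling hG r w q f k) :
    ∃ S : ExplStrategy G r, IsOptimal w q S ∧ S.k = k r := by
  obtain ⟨W, hW⟩ := exists_children_recursion (r := r) hG (fun _ => False) 0
    fun v u x => x + w s(v, u)
  obtain ⟨g, hg⟩ := exists_children_recursion (r := r) hG (fun v => k v = 1)
    (fun v => wdepth hG r w (f v) - wdepth hG r w v - (wdepth hG r w v + q))
    fun v u x => max 0 (x + 2 * w s(v, u))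
  simp only [if_false] at hW
  have hg : IsGain hG r w q f k g := hg
  obtain ⟨S, hS, hc⟩ := exists_strategy_label hw hg hk hW
  exact ⟨S, fun S' => hc.trans_le (hg.le_stratCost hw hq hk hW S'), hS⟩

lemma exists_contribution_add_eq (hG : G.IsTree) (r : V) (w : Sym2 V → ℝ) (q : ℝ) (f : V → V)
    (k : V → ℕ) :
    ∃ ε > 0, contribution hG r w (q + ε) f k = contribution hG r w q f k := by
  have h : ∀ᶠ ε : ℝ in nhdsWithin 0 (Set.Ioi 0), ∀ v u,
      contribution hG r w (q + ε) f k v u = contribution hG r w q f k v u := by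
    refine Filter.eventually_all.2 fun v => Filter.eventually_all.2 fun u => ?_
    by_cases hc : wdepth hG r w (f u) - wdepth hG r w v ≤ wdepth hG r w v + q
    · filter_upwards [self_mem_nhdsWithin] with ε hε
      have hε : 0 < ε := hε
      have : wdepth hG r w (f u) - wdepth hG r w v ≤ wdepth hG r w v + (q + ε) := by linarith
      simp only [contribution, hc, this]
    · have hpos : 0 < wdepth hG r w (f u) - wdepth hG r w v - (wdepth hG r w v + q) := by
        linarith
      filter_upwards [Ioo_mem_nhdsGT hpos] with ε hε
      have : ¬ wdepth hG r w (f u) - wdepth hG r w v ≤ wdepth hG r w v + (q + ε) := by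
        have := hε.2
        intro h
        linarith
      simp only [contribution, hc, this]
  obtain ⟨ε, h, hε⟩ := (h.and self_mem_nhdsWithin).exists
  exact ⟨ε, hε, funext fun v => funext fun u => h v u⟩

lemma IsLabeling.isLeast {hG : G.IsTree} (hw : ∀ e ∈ G.edgeSet, 0 < w e) (hq : 0 ≤ q)
    (hk : IsLabeling hG r w q f k) :
    IsLeast {m : ℕ | ∃ S : ExplStrategy G r, IsOptimal w q S ∧ S.k = m} (k r) := by
  refine ⟨hk.exists_isOptimal hw hq, ?_⟩
  rintro _ ⟨S, hS, rfl⟩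
  obtain ⟨ε, hε, heq⟩ := exists_contribution_add_eq hG r w q f k
  have hk' : IsLabeling hG r w (q + ε) f k :=
    ⟨hk.isDesc, hk.mono, hk.attained, by rw [heq]; exact hk.label_eq⟩
  obtain ⟨S', hS', hSk⟩ := hk'.exists_isOptimal hw (by positivity)
  have h1 := hS S'
  have h2 := hS' S
  simp only [stratCost, hSk] at h1 h2
  have h3 : (k r : ℝ) * ε ≤ S.k * ε := by linarith
  exact_mod_cast le_of_mul_le_mul_right h3 hε

lemma isLabeling_of_furthest_leaf (hG : G.IsTree)
    (hf : ∀ u, IsTLeaf G r (f u) ∧ IsDesc G r u (f u) ∧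
      ∀ x, IsTLeaf G r x → IsDesc G r u x → wdepth hG r w x ≤ wdepth hG r w (f u))
    (hk : ∀ v, k v = max 1 (∑ u ∈ childrenFinset G r v, contribution hG r w q f k v u)) :
    IsLabeling hG r w q f k where
  isDesc v := (hf v).2.1
  mono v u h := (hf v).2.2 _ (hf u).1 (ReflTransGen.head h (hf u).2.1)
  attained v u h := by
    rcases (hf v).2.1.cases_child with hv | ⟨u', hu', hd⟩
    · exact (not_isTChild_of_isTLeaf hG (hf v).1 (hv ▸ h)).elim
    · exact ⟨u', hu', le_antisymm
        ((hf v).2.2 _ (hf u').1 (ReflTransGen.head hu' (hf u').2.1)) ((hf u').2.2 _ (hf v).1 hd)⟩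
  label_eq := hk

end LowerBound

open scoped Classical in
/-- Given the recursively defined labeling `k` (with `k v = 1` for leaves, and
`k v = max 1 (Σ_{u child of v} κ(u))` for non-leaves, where `κ(u) = k u - 1` when
`k u = 1` and the furthest leaf `f u` of `T_u` satisfies `d(v, f u) ≤ d(r, v) + q`,
and `κ(u) = k u` otherwise), there is a cost-optimal exploration strategy with
exactly `k r` walks, and every cost-optimal strategy has at least `k r` walks:
the minimum number of agents used by a cost-optimal strategy equals `k r`. -/
theorem labeling_gives_optimal_agent_number {V : Type*} [Fintype V]
    (G : SimpleGraph V) (hG : G.IsTree) (hcard : 1 < Fintype.card V)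
    (r : V) (w : Sym2 V → ℝ) (hw : ∀ e ∈ G.edgeSet, 0 < w e)
    (q : ℝ) (hq : 0 ≤ q)
    (hcompressed : ∀ v : V, v ≠ r → ¬ IsTLeaf G r v → 2 ≤ (childrenFinset G r v).card)
    (f : V → V)
    (hf : ∀ u : V, u ≠ r →
        IsTLeaf G r (f u) ∧ InSubtree G r u (f u) ∧
        ∀ x, IsTLeaf G r x → InSubtree G r u x → wdist G w u x ≤ wdist G w u (f u))
    (k : V → ℕ)
    (hk_leaf : ∀ v, IsTLeaf G r v → k v = 1)
    (hk_node : ∀ v, ¬ IsTLeaf G r v →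
        k v = max 1 (∑ u ∈ childrenFinset G r v,
          if k u = 1 ∧ wdist G w v (f u) ≤ wdist G w r v + q then k u - 1 else k u)) :
    IsLeast {m : ℕ | ∃ S : ExplStrategy G r, IsOptimal w q S ∧ S.k = m} (k r) := by
  obtain ⟨u₀, hu₀⟩ : ∃ u, u ≠ r := Fintype.exists_ne_of_one_lt_card hcard r
  obtain ⟨x₀, hx₀, hmax⟩ := Finset.exists_max_image
    (Finset.univ.filter fun x => IsTLeaf G r x) (wdepth hG r w)
    ⟨f u₀, Finset.mem_filter.2 ⟨Finset.mem_univ _, (hf u₀ hu₀).1⟩⟩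
  have hx₀ := (Finset.mem_filter.1 hx₀).2
  have hf' : ∀ u, u ≠ r → Function.update f r x₀ u = f u := fun u hu =>
    Function.update_of_ne hu _ _
  refine (isLabeling_of_furthest_leaf (f := Function.update f r x₀) hG ?_ ?_).isLeast hw hq
  · intro u
    by_cases hu : u = r
    · subst hu
      rw [Function.update_self]
      exact ⟨hx₀, isDesc_root hG _, fun x hx _ =>
        hmax x (Finset.mem_filter.2 ⟨Finset.mem_univ _, hx⟩)⟩
    · rw [hf' u hu]
      obtain ⟨h1, h2, h3⟩ := hf u hu
      have h2 := (inSubtree_iff_isDesc hG).1 h2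
      refine ⟨h1, h2, fun x hx hd => ?_⟩
      have := h3 x hx ((inSubtree_iff_isDesc hG).2 hd)
      rw [wdist_eq hG hw hd, wdist_eq hG hw h2] at this
      linarith
  · intro v
    by_cases hv : IsTLeaf G r v
    · rw [hk_leaf v hv, Finset.sum_eq_zero, max_eq_left zero_le_one]
      exact fun u hu => (not_isTChild_of_isTLeaf hG hv (mem_childrenFinset.1 hu)).elim
    · rw [hk_node v hv]
      congr 1
      refine Finset.sum_congr rfl fun u hu => ?_
      have hu := mem_childrenFinset.1 hu
      have hur : u ≠ r := fun h => not_isTChild_root hG (h ▸ hu)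
      have hd := (inSubtree_iff_isDesc hG).1 (hf u hur).2.1
      rw [wdist_eq hG hw (ReflTransGen.head hu hd), wdist_eq hG hw (isDesc_root hG v),
        wdepth_root, sub_zero, contribution, hf' u hur]
      split_ifs with h
      · rw [h.1]
      · rfl
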